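/- arXiv:2601.02912 — 3 statements merged into one kernel-verified Lean document; each statement's English description precedes it below -/
import Mathlib

section
/- There exist a nonnegative integer q₀, a positive integer ρ, and a family of polynomials f_d ∈ ℤ[t] indexed by the positive divisors d of ρ, such that for every integer q > q₀ one has N_{A,𝒂,B,𝒃}(q) = f_{gcd(q,ρ)}(q). In particular, for all integers a,b > q₀ with gcd(a,ρ) = gcd(b,ρ), the counting function is given by the same polynomial (the gcd property), and N_{A,𝒂,B,𝒃} agrees for q > q₀ with a quasi-polynomial with period ρ. -/
open Matrix

/-- `F` agrees for all large `q` with a quasi-polynomial with integer coefficients whose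
constituent at `q` depends only on the gcd of `q` with a period `ρ`. -/
def IsGcdQuasiPoly (F : ℕ → ℤ) : Prop :=
  ∃ q₀ ρ : ℕ, 0 < ρ ∧ ∃ f : ℕ → Polynomial ℤ,
    ∀ q, q₀ < q → F q = (f (q.gcd ρ)).eval (q : ℤ)

namespace IsGcdQuasiPoly

variable {F G : ℕ → ℤ}

theorem of_eval (p : Polynomial ℤ) : IsGcdQuasiPoly fun q => p.eval (q : ℤ) :=
  ⟨0, 1, one_pos, fun _ => p, fun _ _ => rfl⟩

theorem congr (hF : IsGcdQuasiPoly F) {q₁ : ℕ} (h : ∀ q, q₁ < q → G q = F q) :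
    IsGcdQuasiPoly G := by
  obtain ⟨q₀, ρ, hρ, f, hf⟩ := hF
  refine ⟨max q₀ q₁, ρ, hρ, f, fun q hq => ?_⟩
  rw [h q (lt_of_le_of_lt (le_max_right _ _) hq), hf q (lt_of_le_of_lt (le_max_left _ _) hq)]

theorem of_gcd {ρ : ℕ} (hρ : 0 < ρ) (h : ℕ → ℤ) : IsGcdQuasiPoly fun q => h (q.gcd ρ) :=
  ⟨0, ρ, hρ, fun d => Polynomial.C (h d), fun q _ => by simp⟩

theorem map₂ (op : ℤ → ℤ → ℤ) (pop : Polynomial ℤ → Polynomial ℤ → Polynomial ℤ)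
    (hop : ∀ p r : Polynomial ℤ, ∀ x, (pop p r).eval x = op (p.eval x) (r.eval x))
    (hF : IsGcdQuasiPoly F) (hG : IsGcdQuasiPoly G) :
    IsGcdQuasiPoly fun q => op (F q) (G q) := by
  obtain ⟨q₀, ρ, hρ, f, hf⟩ := hF
  obtain ⟨q₁, σ, hσ, g, hg⟩ := hG
  refine ⟨max q₀ q₁, ρ * σ, Nat.mul_pos hρ hσ, fun d => pop (f (d.gcd ρ)) (g (d.gcd σ)),
    fun q hq => ?_⟩
  dsimp only
  rw [hop, Nat.gcd_assoc, Nat.gcd_assoc, Nat.gcd_eq_right (Nat.dvd_mul_right ρ σ),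
    Nat.gcd_eq_right (Nat.dvd_mul_left σ ρ), hf q (lt_of_le_of_lt (le_max_left _ _) hq),
    hg q (lt_of_le_of_lt (le_max_right _ _) hq)]

theorem sub (hF : IsGcdQuasiPoly F) (hG : IsGcdQuasiPoly G) :
    IsGcdQuasiPoly fun q => F q - G q :=
  map₂ (· - ·) (· - ·) (by simp) hF hG

theorem mul (hF : IsGcdQuasiPoly F) (hG : IsGcdQuasiPoly G) :
    IsGcdQuasiPoly fun q => F q * G q :=
  map₂ (· * ·) (· * ·) (by simp) hF hG

theorem prod {ι : Type*} (s : Finset ι) {H : ι → ℕ → ℤ} (h : ∀ i ∈ s, IsGcdQuasiPoly (H i)) :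
    IsGcdQuasiPoly fun q => ∏ i ∈ s, H i q := by
  classical
  induction s using Finset.induction_on with
  | empty => simpa using of_eval 1
  | insert i s hi ih =>
    simp only [Finset.prod_insert hi]
    exact (h i (by simp)).mul (ih fun j hj => h j (by simp [hj]))

end IsGcdQuasiPoly

theorem ZMod.exists_intCast_mul_eq_iff (q : ℕ) (e c : ℤ) :
    (∃ z : ZMod q, (e : ZMod q) * z = c) ↔ (Int.gcd e q : ℤ) ∣ c := by
  constructor
  · rintro ⟨z, hz⟩
    obtain ⟨z, rfl⟩ := ZMod.intCast_surjective z
    rw [← Int.cast_mul, ZMod.intCast_eq_intCast_iff_dvd_sub] at hz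
    have h := (Int.gcd_dvd_right e q).trans hz
    exact (dvd_sub_left ((Int.gcd_dvd_left e q).mul_right z)).1 h
  · rintro ⟨y, rfl⟩
    refine ⟨Int.gcdA e q * y, ?_⟩
    rw [Int.gcd_eq_gcd_ab]
    push_cast
    rw [ZMod.natCast_self]
    ring

theorem ZMod.card_intCast_mul_eq_zero (q : ℕ) [NeZero q] (e : ℤ) :
    Nat.card {z : ZMod q // (e : ZMod q) * z = 0} = Int.gcd e q := by
  have h := AddSubgroup.card_mul_index (AddMonoidHom.mulLeft (e : ZMod q)).ker
  have hr : (AddMonoidHom.mulLeft (e : ZMod q)).range =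
      AddSubgroup.zmultiples (e.natAbs : ZMod q) := by
    have hz : AddSubgroup.zmultiples (e.natAbs : ZMod q) = AddSubgroup.zmultiples (e : ZMod q) := by
      obtain h | h := Int.natAbs_eq e
      · conv_rhs => rw [h, Int.cast_natCast]
      · conv_rhs => rw [h, Int.cast_neg, AddSubgroup.zmultiples_neg, Int.cast_natCast]
    rw [hz]
    ext x
    simp only [AddMonoidHom.mem_range, AddMonoidHom.coe_mulLeft, AddSubgroup.mem_zmultiples_iff]
    constructor
    · rintro ⟨z, rfl⟩
      obtain ⟨z, rfl⟩ := ZMod.intCast_surjective z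
      exact ⟨z, by simp [mul_comm]⟩
    · rintro ⟨z, rfl⟩
      exact ⟨z, by simp [mul_comm]⟩
  have hq : q ≠ 0 := NeZero.ne q
  rw [AddSubgroup.index_ker, hr, Nat.card_zmultiples, ZMod.addOrderOf_coe _ hq,
    Nat.card_zmod] at h
  have hd : q.gcd e.natAbs ∣ q := Nat.gcd_dvd_left _ _
  have hpos : 0 < q / q.gcd e.natAbs :=
    Nat.div_pos (Nat.le_of_dvd hq.bot_lt hd) (Nat.gcd_pos_of_pos_left _ hq.bot_lt)
  have hcard : Nat.card (AddMonoidHom.mulLeft (e : ZMod q)).ker = q.gcd e.natAbs :=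
    Nat.eq_of_mul_eq_mul_right hpos (h.trans (Nat.mul_div_cancel' hd).symm)
  rw [Nat.gcd_comm] at hcard
  exact hcard

theorem ZMod.card_intCast_mul_eq (q : ℕ) [NeZero q] (e c : ℤ) :
    Nat.card {z : ZMod q // (e : ZMod q) * z = c} =
      if (Int.gcd e q : ℤ) ∣ c then Int.gcd e q else 0 := by
  split_ifs with h
  · obtain ⟨w, hw⟩ := (ZMod.exists_intCast_mul_eq_iff q e c).2 h
    rw [← ZMod.card_intCast_mul_eq_zero q e]
    refine Nat.card_congr ((Equiv.subRight w).subtypeEquiv fun z => ?_)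
    simp [mul_sub, hw, sub_eq_zero]
  · rw [← ZMod.exists_intCast_mul_eq_iff] at h
    have : IsEmpty {z : ZMod q // (e : ZMod q) * z = c} := ⟨fun z => h ⟨z, z.2⟩⟩
    exact Nat.card_of_isEmpty

namespace IsGcdQuasiPoly

theorem card_intCast_mul_eq {e : ℤ} (he : e ≠ 0) (c : ℤ) :
    IsGcdQuasiPoly fun q => Nat.card {z : ZMod q // (e : ZMod q) * z = c} := by
  refine (of_gcd (Int.natAbs_pos.2 he)
    fun d => if (d : ℤ) ∣ c then (d : ℤ) else 0).congr (q₁ := 0) fun q hq => ?_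
  have : NeZero q := ⟨hq.ne'⟩
  simp only [ZMod.card_intCast_mul_eq, Int.gcd, Int.natAbs_natCast, Nat.gcd_comm, Nat.cast_ite,
    Nat.cast_zero]

theorem intCast_eq_zero (c : ℤ) :
    IsGcdQuasiPoly fun q => if (c : ZMod q) = 0 then 1 else 0 := by
  refine (of_eval (if c = 0 then 1 else 0)).congr (q₁ := c.natAbs) fun q hq => ?_
  have h : (c : ZMod q) = 0 ↔ c = 0 := by
    rw [ZMod.intCast_zmod_eq_zero_iff_dvd]
    refine ⟨fun h => Int.eq_zero_of_abs_lt_dvd h ?_, by rintro rfl; simp⟩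
    rw [Int.abs_eq_natAbs]
    exact_mod_cast hq
  simp only [h]
  split_ifs <;> simp

end IsGcdQuasiPoly

/-- Over `ℤ` every matrix is equivalent to one whose nonzero entries lie at the positions
`(f i, Sum.inr i)` for an injection `f`. -/
theorem Matrix.exists_mul_mul_eq_diagonal {κ ν : Type*} [Fintype κ] [DecidableEq κ] [Fintype ν]
    [DecidableEq ν] (C : Matrix κ ν ℤ) :
    ∃ (r s : ℕ) (f : Fin r ↪ κ) (e : Fin r → ℤ) (U U' : Matrix κ κ ℤ)
      (V : Matrix ν (Fin s ⊕ Fin r) ℤ) (V' : Matrix (Fin s ⊕ Fin r) ν ℤ),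
      (∀ i, e i ≠ 0) ∧ U' * U = 1 ∧ V * V' = 1 ∧ V' * V = 1 ∧
      U * C * V = .of fun k => Sum.elim 0 fun i => if f i = k then e i else 0 := by
  set φ := Matrix.toLin' C with hφ
  obtain ⟨r, S⟩ := Submodule.smithNormalForm (Pi.basisFun ℤ κ) (LinearMap.range φ)
  have : Module.Free ℤ (LinearMap.range φ) := Module.Free.of_basis S.bN
  obtain ⟨g, hg⟩ := Module.projective_lifting_property φ.rangeRestrict LinearMap.id
    φ.surjective_rangeRestrict
  have hg' (y) : φ (g y) = y := congrArg Subtype.val (LinearMap.congr_fun hg y)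
  let E : (LinearMap.ker φ × LinearMap.range φ) ≃ₗ[ℤ] (ν → ℤ) :=
    LinearEquiv.ofBijective ((LinearMap.ker φ).subtype.coprod g) (by
      constructor
      · rw [← LinearMap.ker_eq_bot, LinearMap.ker_eq_bot']
        rintro ⟨x, y⟩ h
        have hx : φ x = 0 := x.2
        simp only [LinearMap.coprod_apply, Submodule.subtype_apply] at h
        have hy := congrArg φ h
        rw [map_add, hx, hg', zero_add, map_zero] at hy
        have hy' : y = 0 := Subtype.ext hy
        subst hy'
        simpa using h
      · intro x
        refine ⟨(⟨x - g (φ.rangeRestrict x), ?_⟩, φ.rangeRestrict x), by simp⟩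
        rw [LinearMap.mem_ker, map_sub, hg']
        simp)
  have hE (p) : E p = p.1 + g p.2 := rfl
  let bν := ((Module.finBasis ℤ (LinearMap.ker φ)).prod S.bN).map E
  refine ⟨r, _, S.f, S.a, S.bM.toMatrix (Pi.basisFun ℤ κ), (Pi.basisFun ℤ κ).toMatrix S.bM,
    (Pi.basisFun ℤ ν).toMatrix bν, bν.toMatrix (Pi.basisFun ℤ ν), fun i hi => ?_,
    Module.Basis.toMatrix_mul_toMatrix_flip _ _, Module.Basis.toMatrix_mul_toMatrix_flip _ _,
    Module.Basis.toMatrix_mul_toMatrix_flip _ _, ?_⟩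
  · apply S.bN.ne_zero i
    apply Subtype.ext
    rw [S.snf, hi, zero_smul, Submodule.coe_zero]
  · have hC : C = LinearMap.toMatrix (Pi.basisFun ℤ ν) (Pi.basisFun ℤ κ) φ := by
      rw [hφ, ← Matrix.toLin_eq_toLin', LinearMap.toMatrix_toLin]
    rw [hC, basis_toMatrix_mul_linearMap_toMatrix_mul_basis_toMatrix]
    ext k (j | i)
    · have : φ (bν (Sum.inl j)) = 0 := by
        simp [bν, hE]
      simp [LinearMap.toMatrix_apply, this]
    · have : φ (bν (Sum.inr i)) = S.a i • S.bM (S.f i) := by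
        simp [bν, hE, hg', S.snf, -zsmul_eq_mul]
      simp [LinearMap.toMatrix_apply, this, Finsupp.single_apply, -zsmul_eq_mul]

theorem IsGcdQuasiPoly.card_mulVec_eq {κ ν : Type*} [Fintype κ] [Fintype ν]
    (C : Matrix κ ν ℤ) (c : κ → ℤ) :
    IsGcdQuasiPoly fun q => Nat.card {x : ν → ZMod q //
      ∀ k, (C.map (Int.cast : ℤ → ZMod q)).mulVec x k = (c k : ZMod q)} := by
  classical
  obtain ⟨r, s, f, e, U, U', V, V', he, hU, hV, hV', hD⟩ := C.exists_mul_mul_eq_diagonal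
  refine ((of_eval (Polynomial.X ^ s)).mul ((prod Finset.univ fun i _ =>
    card_intCast_mul_eq (he i) (U.mulVec c (f i))).mul
      (prod (Finset.univ.filter fun k => k ∉ Set.range f) fun k _ =>
        intCast_eq_zero (U.mulVec c k)))).congr (q₁ := 0) fun q hq => ?_
  have : NeZero q := ⟨hq.ne'⟩
  let π := Int.castRingHom (ZMod q)
  let W := V.map π
  let W' := V'.map π
  have hW : W * W' = 1 := by
    rw [← Matrix.map_mul, hV, Matrix.map_one _ (map_zero _) (map_one _)]
  have hW' : W' * W = 1 := by
    rw [← Matrix.map_mul, hV', Matrix.map_one _ (map_zero _) (map_one _)]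
  have hUπ : U'.map π * U.map π = 1 := by
    rw [← Matrix.map_mul, hU, Matrix.map_one _ (map_zero _) (map_one _)]
  have hDπ : U.map π * C.map π * W =
      .of fun k => Sum.elim 0 fun i => if f i = k then (e i : ZMod q) else 0 := by
    rw [← Matrix.map_mul, ← Matrix.map_mul, hD]
    ext k (j | i)
    · simp
    · by_cases h : f i = k <;> simp [h, π]
  let eqv : (Fin s ⊕ Fin r → ZMod q) ≃ (ν → ZMod q) :=
    { toFun := W.mulVec
      invFun := W'.mulVec
      left_inv := fun x => by rw [Matrix.mulVec_mulVec, hW', Matrix.one_mulVec]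
      right_inv := fun x => by rw [Matrix.mulVec_mulVec, hW, Matrix.one_mulVec] }
  have hinj : Function.Injective (U.map π).mulVec := fun x y h => by
    simpa [Matrix.mulVec_mulVec, hUπ] using congrArg (U'.map π).mulVec h
  have hsol (y : Fin s ⊕ Fin r → ZMod q) :
      (∀ k, (C.map π).mulVec (eqv y) k = (c k : ZMod q)) ↔
        (∀ i, (e i : ZMod q) * y (Sum.inr i) = (U.mulVec c (f i) : ℤ)) ∧
        ∀ k ∉ Set.range f, ((U.mulVec c k : ℤ) : ZMod q) = 0 := by
    have hc : (U.map π).mulVec (fun k => (c k : ZMod q)) =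
        fun k => ((U.mulVec c k : ℤ) : ZMod q) := by
      ext k
      exact (RingHom.map_mulVec π U c k).symm
    have hy : (U.map π).mulVec ((C.map π).mulVec (eqv y)) =
        fun k => ∑ i, if f i = k then (e i : ZMod q) * y (Sum.inr i) else 0 := by
      change (U.map π).mulVec ((C.map π).mulVec (W.mulVec y)) = _
      rw [Matrix.mulVec_mulVec, Matrix.mulVec_mulVec, hDπ]
      ext k
      simp [Matrix.mulVec, dotProduct]
    rw [← funext_iff (g := fun k => (c k : ZMod q)), ← hinj.eq_iff, hc, hy, funext_iff]
    constructor
    · refine fun h => ⟨fun i => ?_, fun k hk => ?_⟩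
      · simpa [f.injective.eq_iff] using h (f i)
      · rw [← h k]
        exact Finset.sum_eq_zero fun i _ => if_neg fun hi => hk ⟨i, hi⟩
    · rintro ⟨h₁, h₂⟩ k
      by_cases hk : k ∈ Set.range f
      · obtain ⟨i, rfl⟩ := hk
        simpa [f.injective.eq_iff] using h₁ i
      · rw [h₂ k hk]
        exact Finset.sum_eq_zero fun i _ => if_neg fun hi => hk ⟨i, hi⟩
  have hcard := Nat.card_congr (eqv.subtypeEquiv
    (q := fun x => ∀ k, (C.map π).mulVec x k = (c k : ZMod q)) fun y => (hsol y).symm)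
  change ((Nat.card {x : ν → ZMod q // ∀ k, (C.map π).mulVec x k = (c k : ZMod q)} : ℕ) : ℤ) = _
  rw [← hcard]
  by_cases h₂ : ∀ k ∉ Set.range f, ((U.mulVec c k : ℤ) : ZMod q) = 0
  · let split : {y : Fin s ⊕ Fin r → ZMod q //
          ∀ i, (e i : ZMod q) * y (Sum.inr i) = (U.mulVec c (f i) : ℤ)} ≃
        (Fin s → ZMod q) × ∀ i, {z : ZMod q // (e i : ZMod q) * z = (U.mulVec c (f i) : ℤ)} :=
      { toFun := fun y => (fun j => y.1 (Sum.inl j), fun i => ⟨y.1 (Sum.inr i), y.2 i⟩)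
        invFun := fun p => ⟨Sum.elim p.1 fun i => (p.2 i).1, fun i => (p.2 i).2⟩
        left_inv := fun y => by ext (j | i) <;> rfl
        right_inv := fun p => rfl }
    rw [Finset.prod_eq_one (s := Finset.univ.filter _)]
    · rw [Nat.card_congr (Equiv.subtypeEquivRight fun _ => and_iff_left h₂), Nat.card_congr split,
        Nat.card_prod, Nat.card_pi, Nat.card_pi]
      simp
    · intro k hk
      exact if_pos (h₂ k (by simpa using hk))
  · have : IsEmpty {y : Fin s ⊕ Fin r → ZMod q //
        (∀ i, (e i : ZMod q) * y (Sum.inr i) = (U.mulVec c (f i) : ℤ)) ∧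
        ∀ k ∉ Set.range f, ((U.mulVec c k : ℤ) : ZMod q) = 0} := ⟨fun y => h₂ y.2.2⟩
    rw [Nat.card_of_isEmpty]
    push Not at h₂
    obtain ⟨k, hk, hk0⟩ := h₂
    rw [Finset.prod_eq_zero (s := Finset.univ.filter _) (i := k) (by simpa using hk) (if_neg hk0)]
    simp

theorem IsGcdQuasiPoly.card_mulVec_eq_and_ne {ι ν : Type*} [Fintype ν]
    (C : Matrix ι ν ℤ) (c : ι → ℤ) (S T : Finset ι) :
    IsGcdQuasiPoly fun q => Nat.card {x : ν → ZMod q //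
      (∀ k ∈ S, (C.map (Int.cast : ℤ → ZMod q)).mulVec x k = (c k : ZMod q)) ∧
      ∀ k ∈ T, (C.map (Int.cast : ℤ → ZMod q)).mulVec x k ≠ (c k : ZMod q)} := by
  classical
  induction T using Finset.induction_on generalizing S with
  | empty =>
    refine (card_mulVec_eq (C.submatrix (Subtype.val : S → ι) id) fun k => c k).congr (q₁ := 0)
      fun q _ => ?_
    congr 1
    refine Nat.card_congr (Equiv.subtypeEquivRight fun x => ?_)
    simp only [Finset.notMem_empty, false_implies, implies_true, and_true, Subtype.forall]
    rfl
  | insert i T _ ih =>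
    refine ((ih S).sub (ih (insert i S))).congr (q₁ := 0) fun q hq => ?_
    have : NeZero q := ⟨hq.ne'⟩
    rw [eq_sub_iff_add_eq]
    norm_cast
    simp only [Nat.card_eq_fintype_card, Fintype.card_subtype]
    rw [← Finset.card_filter_add_card_filter_not
      (s := Finset.univ.filter fun x : ν → ZMod q => (∀ k ∈ S, _) ∧ ∀ k ∈ T, _)
      (fun x => (C.map (Int.cast : ℤ → ZMod q)).mulVec x i ≠ (c i : ZMod q)),
      Finset.filter_filter, Finset.filter_filter]
    congr 2 <;> ext x <;> simp <;> tauto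

/-- There exist `q₀ ≥ 0`, a positive period `ρ`, and a family of integer
polynomials indexed by the positive divisors of `ρ` such that for every `q > q₀` the
complement count `N_{A,a,B,b}(q)` equals the polynomial indexed by `gcd(q,ρ)` evaluated
at `q` (characteristic quasi-polynomial with the gcd property). -/
theorem statement2 {m n l : ℕ} (A : Matrix (Fin m) (Fin n) ℤ) (a : Fin m → ℤ)
    (B : Matrix (Fin l) (Fin n) ℤ) (b : Fin l → ℤ) :
    ∃ (q₀ : ℕ) (ρ : ℕ), 0 < ρ ∧
      ∃ f : ∀ d : ℕ, d ∣ ρ → Polynomial ℤ,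
        ∀ q : ℕ, q₀ < q →
          (Nat.card {x : Fin n → ZMod q //
              (∀ k, (B.map (Int.cast : ℤ → ZMod q)).mulVec x k = (b k : ZMod q)) ∧
              ∀ i, (A.map (Int.cast : ℤ → ZMod q)).mulVec x i ≠ (a i : ZMod q)} : ℤ) =
            (f (Nat.gcd q ρ) (Nat.gcd_dvd_right q ρ)).eval (q : ℤ) := by
  obtain ⟨q₀, ρ, hρ, f, hf⟩ := IsGcdQuasiPoly.card_mulVec_eq_and_ne
    (Matrix.fromRows B A) (Sum.elim b a) (Finset.univ.map .inl) (Finset.univ.map .inr)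
  refine ⟨q₀, ρ, hρ, fun d _ => f d, fun q hq => ?_⟩
  rw [← hf q hq]
  congr 1
  refine Nat.card_congr (Equiv.subtypeEquivRight fun x => ?_)
  simp only [Finset.mem_map, Finset.mem_univ, true_and, forall_exists_index,
    forall_apply_eq_imp_iff]
  rfl
end

section
/- Assume the central case 𝒂 = 0 and 𝒃 = 0. Let r := rank B and s := rank of the stacked matrix [B; A], and for a positive integer q and r ≤ j ≤ s define S_j(q) := (−1)^{j−r} Σ_J (−1)^{|J|} · #{x ∈ (ℤ/qℤ)^n : C_J x ≡ 0 (mod q)}, the sum over all J ⊆ {1,…,m} with rank C_J = j. Then for all positive integers a and b with gcd(a, ρ_C) dividing gcd(b, ρ_C), and every j with r ≤ j ≤ s, one has 0 ≤ S_j(a) and b^{n−j} · S_j(a) ≤ a^{n−j} · S_j(b). -/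
open Matrix

/-- The rank over `ℚ` of an integer matrix. -/
noncomputable def rkQ {ι κ : Type*} [Fintype ι] [Fintype κ] (M : Matrix ι κ ℤ) : ℕ :=
  (M.map (Int.cast : ℤ → ℚ)).rank

/-- The matrix `C_J`: `B` stacked on top of the rows of `A` indexed by `J`. -/
def stackJ {m n l : ℕ} (B : Matrix (Fin l) (Fin n) ℤ) (A : Matrix (Fin m) (Fin n) ℤ)
    (J : Finset (Fin m)) : Matrix (Fin l ⊕ {i // i ∈ J}) (Fin n) ℤ :=
  Matrix.fromRows B (A.submatrix (fun i : {i // i ∈ J} => i.1) id)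

/-- `g_k(M)`: the gcd of the (absolute values of) determinants of all `k×k` submatrices
of `M` (equal to `1` for `k = 0`). -/
noncomputable def minorGcd {ι κ : Type*} [Fintype ι] [Fintype κ] [DecidableEq ι] [DecidableEq κ]
    (M : Matrix ι κ ℤ) (k : ℕ) : ℕ :=
  Finset.gcd Finset.univ
    (fun p : (Fin k ↪ ι) × (Fin k ↪ κ) => (M.submatrix p.1 p.2).det.natAbs)

/-- The `k`-th invariant factor `d_k(M) = g_k(M) / g_{k−1}(M)`. -/
noncomputable def invFactor {ι κ : Type*} [Fintype ι] [Fintype κ] [DecidableEq ι] [DecidableEq κ]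
    (M : Matrix ι κ ℤ) (k : ℕ) : ℕ :=
  minorGcd M k / minorGcd M (k - 1)

/-- `ρ_C` in the central case: the lcm of the maximal invariant factors
`d_{rank C_J}(C_J)` over all `J ⊆ {1,…,m}`. -/
noncomputable def rhoC0 {m n l : ℕ} (A : Matrix (Fin m) (Fin n) ℤ)
    (B : Matrix (Fin l) (Fin n) ℤ) : ℕ :=
  Finset.lcm Finset.univ
    (fun J : Finset (Fin m) => invFactor (stackJ B A J) (rkQ (stackJ B A J)))

/-- `S_j(q) = (−1)^{j−r} Σ_J (−1)^{|J|} #{x : C_J x ≡ 0 (mod q)}`, the sum being over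
all `J ⊆ {1,…,m}` with `rank C_J = j`, where `r = rank B` (central case). -/
noncomputable def Sj0 {m n l : ℕ} (A : Matrix (Fin m) (Fin n) ℤ)
    (B : Matrix (Fin l) (Fin n) ℤ) (j q : ℕ) : ℤ :=
  (-1 : ℤ) ^ (j - rkQ B) *
    ∑ J ∈ Finset.univ.filter (fun J : Finset (Fin m) => rkQ (stackJ B A J) = j),
      (-1 : ℤ) ^ J.card *
        (Nat.card {x : Fin n → ZMod q //
          ∀ i, ((stackJ B A J).map (Int.cast : ℤ → ZMod q)).mulVec x i = 0} : ℤ)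

section

open Module

lemma minorGcd_dvd_det {ι κ : Type*} [Fintype ι] [Fintype κ] [DecidableEq ι] [DecidableEq κ]
    (M : Matrix ι κ ℤ) {k : ℕ} (f : Fin k ↪ ι) (g : Fin k ↪ κ) :
    (minorGcd M k : ℤ) ∣ (M.submatrix f g).det :=
  Int.natCast_dvd.mpr (Finset.gcd_dvd
    (f := fun p : (Fin k ↪ ι) × (Fin k ↪ κ) => (M.submatrix p.1 p.2).det.natAbs)
    (Finset.mem_univ (f, g)))

lemma minorGcd_dvd_adjugate {ι κ : Type*} [Fintype ι] [Fintype κ] [DecidableEq ι] [DecidableEq κ]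
    (M : Matrix ι κ ℤ) {k : ℕ} (f : Fin k ↪ ι) (g : Fin k ↪ κ) (i j : Fin k) :
    (minorGcd M (k - 1) : ℤ) ∣ (M.submatrix f g).adjugate i j := by
  cases k with
  | zero => exact i.elim0
  | succ k =>
    rw [Matrix.adjugate_fin_succ_eq_det_submatrix]
    exact Dvd.dvd.mul_left (minorGcd_dvd_det M ((Fin.succAboveEmb j).trans f)
      ((Fin.succAboveEmb i).trans g)) _

lemma minorGcd_pred_dvd {ι κ : Type*} [Fintype ι] [Fintype κ] [DecidableEq ι] [DecidableEq κ]
    (M : Matrix ι κ ℤ) (k : ℕ) : minorGcd M (k - 1) ∣ minorGcd M k := by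
  cases k with
  | zero => exact dvd_rfl
  | succ k =>
    refine Finset.dvd_gcd fun p _ => Int.natCast_dvd.mp ?_
    rw [Matrix.det_succ_row_zero]
    refine Finset.dvd_sum fun j _ => Dvd.dvd.mul_left ?_ _
    exact minorGcd_dvd_det M ((Fin.succAboveEmb 0).trans p.1)
      ((Fin.succAboveEmb j).trans p.2)

/-- Two vectors of the row space of `M` agree once they agree on the columns of a nonsingular
minor of maximal size. -/
lemma eq_zero_of_mem_span_row {ι κ K : Type*} [Fintype ι] [Fintype κ] [Field K]
    (M : Matrix ι κ K) {r : ℕ} (hr : M.rank = r) (f : Fin r ↪ ι) (g : Fin r ↪ κ)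
    (hdet : (M.submatrix f g).det ≠ 0) {w : κ → K}
    (hw : w ∈ Submodule.span K (Set.range M.row)) (hwg : ∀ i, w (g i) = 0) : w = 0 := by
  have hli' := Matrix.linearIndependent_rows_of_det_ne_zero hdet
  have hli : LinearIndependent K (fun i => M.row (f i)) :=
    LinearIndependent.of_comp (LinearMap.funLeft K K g) hli'
  have hspan : Submodule.span K (Set.range fun i => M.row (f i)) =
      Submodule.span K (Set.range M.row) := by
    apply Submodule.eq_of_le_of_finrank_eq
    · exact Submodule.span_mono (Set.range_comp_subset_range f M.row)
    · rw [finrank_span_eq_card hli, Fintype.card_fin, ← Matrix.rank_eq_finrank_span_row, hr]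
  rw [← hspan, Submodule.mem_span_range_iff_exists_fun] at hw
  obtain ⟨c, rfl⟩ := hw
  have hc : c = 0 := by
    funext i
    refine Fintype.linearIndependent_iff.mp hli' c ?_ i
    funext j
    simpa [Finset.sum_apply] using hwg j
  simp [hc]

/-- The maximal invariant factor annihilates the saturation of the row lattice modulo the row
lattice. -/
lemma invFactor_smul_mem_span_row {ι κ : Type*} [Fintype ι] [Fintype κ] [DecidableEq ι]
    [DecidableEq κ] (M : Matrix ι κ ℤ) {y : κ → ℤ}
    (hy : (fun k => (y k : ℚ)) ∈
      Submodule.span ℚ (Set.range (M.map (Int.cast : ℤ → ℚ)).row)) :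
    (invFactor M (rkQ M) : ℤ) • y ∈ Submodule.span ℤ (Set.range M.row) := by
  set L := Submodule.span ℤ (Set.range M.row)
  set r := rkQ M
  set g : ℤ := ((minorGcd M (r - 1) : ℕ) : ℤ) with hg
  let I : Submodule ℤ ℤ :=
    (L.map (LinearMap.lsmul ℤ (κ → ℤ) g)).comap (LinearMap.toSpanSingleton ℤ _ y)
  have hI : ∀ d : ℤ, d ∈ I ↔ ∃ z ∈ L, g • z = d • y := fun d => Iff.rfl
  have hdet : ∀ p : (Fin r ↪ ι) × (Fin r ↪ κ), (M.submatrix p.1 p.2).det ∈ I := by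
    rintro ⟨p, q⟩
    by_cases h0 : (M.submatrix p q).det = 0
    · simp only [h0]; exact I.zero_mem
    set D := M.submatrix p q with hD
    choose e he using fun i j => minorGcd_dvd_adjugate M p q i j
    refine (hI _).mpr ⟨∑ i, (∑ j, y (q j) * e j i) • M.row (p i), Submodule.sum_mem _ fun i _ =>
      L.smul_mem _ (Submodule.subset_span ⟨_, rfl⟩), ?_⟩
    have hsum : g • ∑ i, (∑ j, y (q j) * e j i) • M.row (p i) =
        ∑ i, (∑ j, y (q j) * D.adjugate j i) • M.row (p i) := by
      rw [Finset.smul_sum]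
      refine Finset.sum_congr rfl fun i _ => ?_
      rw [smul_smul, Finset.mul_sum]
      congr 1
      refine Finset.sum_congr rfl fun j _ => ?_
      rw [he]; ring
    rw [hsum, ← sub_eq_zero]
    set w := ∑ i, (∑ j, y (q j) * D.adjugate j i) • M.row (p i) - D.det • y with hw
    have hcast : (fun k => (w k : ℚ)) = 0 := by
      refine eq_zero_of_mem_span_row (M.map (Int.cast : ℤ → ℚ)) (r := r) rfl p q ?_ ?_ ?_
      · rw [Matrix.submatrix_map, ← hD]
        have := (Int.castRingHom ℚ).map_det D
        simp only [RingHom.mapMatrix_apply, eq_intCast, Int.coe_castRingHom] at this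
        rw [← this]
        exact_mod_cast h0
      · have : (fun k => (w k : ℚ)) = ∑ i, ((∑ j, y (q j) * D.adjugate j i : ℤ) : ℚ) •
            (M.map (Int.cast : ℤ → ℚ)).row (p i) - (D.det : ℚ) • (fun k => (y k : ℚ)) := by
          funext k
          simp [hw, Finset.sum_apply]
        rw [this]
        exact Submodule.sub_mem _ (Submodule.sum_mem _ fun i _ =>
          Submodule.smul_mem _ _ (Submodule.subset_span ⟨_, rfl⟩)) (Submodule.smul_mem _ _ hy)
      · intro k
        have hadj := congrFun (congrArg (Matrix.vecMul (fun j => y (q j)))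
          (Matrix.adjugate_mul D)) k
        rw [← Matrix.vecMul_vecMul, Matrix.vecMul_smul, Matrix.vecMul_one] at hadj
        simp only [Matrix.vecMul, dotProduct] at hadj
        have : w (q k) = 0 := by
          simp only [hw, Pi.sub_apply, Finset.sum_apply, Pi.smul_apply, smul_eq_mul]
          rw [sub_eq_zero]
          exact hadj
        exact_mod_cast this
    funext k
    exact Int.cast_eq_zero.mp (congrFun hcast k)
  have hmem : (minorGcd M r : ℤ) ∈ I := by
    rw [Submodule.IsPrincipal.mem_iff_generator_dvd I]
    refine Int.dvd_natCast.mpr (Finset.dvd_gcd fun p _ => ?_)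
    exact Int.natAbs_dvd_natAbs.mpr
      ((Submodule.IsPrincipal.mem_iff_generator_dvd I).mp (hdet p))
  obtain ⟨z, hz, hzy⟩ := (hI _).mp hmem
  by_cases h0 : g = 0
  · have : minorGcd M (r - 1) = 0 := Int.natCast_eq_zero.mp h0
    simp [invFactor, this]
  · have hd : (minorGcd M r : ℤ) = g * (invFactor M r : ℤ) := by
      rw [hg, invFactor]
      exact_mod_cast (Nat.mul_div_cancel' (minorGcd_pred_dvd M r)).symm
    rw [hd, mul_smul] at hzy
    rwa [← smul_right_injective _ h0 hzy]

/-- The alternating count of the subfamilies spanning `V` over `U` has sign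
`(-1) ^ (dim V - dim U)`. -/
lemma alternating_spanning_sum_nonneg {K W ι : Type*} [Field K] [AddCommGroup W] [Module K W]
    [FiniteDimensional K W] [DecidableEq ι] (w : ι → W) (V : Submodule K W) (E : Finset ι) :
    ∀ U : Submodule K W, 0 ≤ (-1 : ℤ) ^ (finrank K V + finrank K U) *
      ∑ J ∈ E.powerset, (open Classical in
        if U ⊔ Submodule.span K (w '' J) = V then (-1 : ℤ) ^ J.card else 0) := by
  classical
  induction E using Finset.induction_on with
  | empty =>
    intro U
    by_cases h : U = V
    · subst h
      simp [← two_mul]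
    · simp [h]
  | insert e E he ih =>
    intro U
    rw [Finset.sum_powerset_insert he]
    have hins : ∀ J ∈ E.powerset,
        (if U ⊔ Submodule.span K (w '' (insert e J : Finset ι)) = V
          then (-1 : ℤ) ^ (insert e J).card else 0) =
        -(if (U ⊔ Submodule.span K {w e}) ⊔ Submodule.span K (w '' J) = V
          then (-1 : ℤ) ^ J.card else 0) := by
      intro J hJ
      have heJ : e ∉ J := fun h => he (Finset.mem_powerset.mp hJ h)
      rw [Finset.coe_insert, Set.image_insert_eq, Submodule.span_insert, ← sup_assoc,
        Finset.card_insert_of_notMem heJ, pow_succ]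
      split_ifs <;> simp
    rw [Finset.sum_congr rfl hins, Finset.sum_neg_distrib]
    by_cases hU : w e ∈ U
    · rw [sup_eq_left.mpr ((Submodule.span_singleton_le_iff_mem _ _).mpr hU)]
      simp
    · have h1 := ih U
      have h2 := ih (U ⊔ Submodule.span K {w e})
      rw [Submodule.finrank_sup_span_singleton hU, ← add_assoc, pow_succ] at h2
      linarith

/-- The integral vectors contained in a rational subspace. -/
def integralPoints {κ : Type*} (V : Submodule ℚ (κ → ℚ)) : Submodule ℤ (κ → ℤ) :=
  (V.restrictScalars ℤ).comap ((Int.castAddHom ℚ).toIntLinearMap.compLeft κ)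

lemma mem_integralPoints {κ : Type*} {V : Submodule ℚ (κ → ℚ)} {y : κ → ℤ} :
    y ∈ integralPoints V ↔ (fun k => (y k : ℚ)) ∈ V := Iff.rfl

lemma exists_isCompl_integralPoints {κ : Type*} [Finite κ] (V : Submodule ℚ (κ → ℚ)) :
    ∃ M, IsCompl (integralPoints V) M := by
  have : Module.IsTorsionFree ℤ ((κ → ℤ) ⧸ integralPoints V) := by
    refine Module.IsTorsionFree.of_smul_eq_zero fun c x hx => ?_
    induction x using Submodule.Quotient.induction_on with | _ y
    rw [← Submodule.Quotient.mk_smul, Submodule.Quotient.mk_eq_zero, mem_integralPoints] at hx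
    by_cases hc : c = 0
    · exact Or.inl hc
    · right
      rw [Submodule.Quotient.mk_eq_zero, mem_integralPoints]
      have := V.smul_mem (c : ℚ)⁻¹ hx
      convert this using 1
      funext k
      simp [hc]
  obtain ⟨s, hs⟩ := Module.projective_lifting_property (integralPoints V).mkQ
    LinearMap.id (Submodule.mkQ_surjective _)
  have hmem : ∀ x, (LinearMap.id - s ∘ₗ (integralPoints V).mkQ : (κ → ℤ) →ₗ[ℤ] κ → ℤ) x ∈
      integralPoints V := by
    intro x
    rw [← Submodule.Quotient.mk_eq_zero, ← Submodule.mkQ_apply, LinearMap.sub_apply, map_sub,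
      sub_eq_zero]
    exact (LinearMap.congr_fun hs ((integralPoints V).mkQ x)).symm
  refine ⟨_, LinearMap.isCompl_of_proj (f := LinearMap.codRestrict _ _ hmem) fun x => ?_⟩
  ext k
  have : (integralPoints V).mkQ x.1 = 0 := (Submodule.Quotient.mk_eq_zero _).mpr x.2
  simp [this]

lemma finrank_integralPoints {κ : Type*} [Finite κ] {V : Submodule ℚ (κ → ℚ)}
    (hV : V ≤ Submodule.span ℚ ((fun y k => (y k : ℚ)) '' (integralPoints V : Set (κ → ℤ)))) :
    finrank ℤ (integralPoints V) = finrank ℚ V := by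
  let b := Module.finBasis ℤ (integralPoints V)
  let c : Fin (finrank ℤ (integralPoints V)) → κ → ℚ := fun i k => ((b i).1 k : ℚ)
  have hc : LinearIndependent ℚ c := by
    rw [← LinearIndependent.iff_fractionRing ℤ ℚ]
    refine b.linearIndependent.map' (((Int.castAddHom ℚ).toIntLinearMap.compLeft κ) ∘ₗ
      (integralPoints V).subtype) (LinearMap.ker_eq_bot.mpr fun x y hxy => ?_)
    ext k
    have := congrFun hxy k
    simpa using this
  have hspan : Submodule.span ℚ (Set.range c) = V := by
    refine le_antisymm (Submodule.span_le.mpr ?_) (hV.trans (Submodule.span_le.mpr ?_))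
    · rintro _ ⟨i, rfl⟩
      exact (b i).2
    · rintro _ ⟨y, hy, rfl⟩
      have : (fun k => (y k : ℚ)) = ∑ i, (b.repr ⟨y, hy⟩ i : ℚ) • c i := by
        funext k
        have := congrFun (congrArg Subtype.val (b.sum_repr ⟨y, hy⟩)) k
        simp only [Submodule.coe_sum, Finset.sum_apply, Submodule.coe_smul, Pi.smul_apply,
          smul_eq_mul] at this
        simp only [Finset.sum_apply, Pi.smul_apply, smul_eq_mul, c]
        exact_mod_cast this.symm
      change (fun k => (y k : ℚ)) ∈ Submodule.span ℚ (Set.range c)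
      rw [this]
      exact Submodule.sum_mem _ fun i _ =>
        Submodule.smul_mem _ _ (Submodule.subset_span ⟨i, rfl⟩)
  have := finrank_span_eq_card hc
  rw [hspan, Fintype.card_fin] at this
  exact this.symm

/-- Homomorphisms into `ZMod q` are the `q`-torsion homomorphisms into the circle. -/
noncomputable def homZModEquiv (L : Type*) [AddCommGroup L] (q : ℕ) [NeZero q] :
    (L →ₗ[ℤ] ZMod q) ≃ {φ : L →ₗ[ℤ] UnitAddCircle // q • φ = 0} :=
  Equiv.ofBijective
    (fun f => ⟨(ZMod.toAddCircle (N := q)).toIntLinearMap ∘ₗ f, by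
      ext x
      change q • ZMod.toAddCircle (f x) = 0
      rw [← map_nsmul]; simp⟩)
    (by
      constructor
      · intro f g h
        ext x
        exact ZMod.toAddCircle_injective q (LinearMap.congr_fun (congrArg Subtype.val h) x)
      · rintro ⟨φ, hφ⟩
        have hinj : Function.Injective (ZMod.toAddCircle (N := q)).toIntLinearMap :=
          ZMod.toAddCircle_injective q
        have hmem : ∀ x, φ x ∈ LinearMap.range (ZMod.toAddCircle (N := q)).toIntLinearMap := by
          intro x
          obtain ⟨k, -, hk⟩ := (AddCircle.nsmul_eq_zero_iff (NeZero.pos q)).mp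
            (LinearMap.congr_fun hφ x)
          refine ⟨(k : ZMod q), ?_⟩
          rw [← hk, mul_one]
          exact ZMod.toAddCircle_natCast k
        refine ⟨(LinearEquiv.ofInjective _ hinj).symm ∘ₗ φ.codRestrict _ hmem, ?_⟩
        ext x
        exact congrArg Subtype.val
          ((LinearEquiv.ofInjective _ hinj).apply_symm_apply ⟨φ x, hmem x⟩))

lemma homZModEquiv_apply_eq_zero {L : Type*} [AddCommGroup L] {q : ℕ} [NeZero q]
    (f : L →ₗ[ℤ] ZMod q) (x : L) : (homZModEquiv L q f).1 x = 0 ↔ f x = 0 :=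
  ZMod.toAddCircle_eq_zero

lemma finite_torsion_hom (L : Type*) [AddCommGroup L] [Module.Finite ℤ L] [Module.Free ℤ L]
    (q : ℕ) [NeZero q] : {φ : L →ₗ[ℤ] UnitAddCircle | q • φ = 0}.Finite := by
  have : Finite (L →ₗ[ℤ] ZMod q) :=
    Finite.of_equiv _ ((Module.finBasis ℤ L).constr ℤ (M' := ZMod q)).toEquiv
  have h : Finite {φ : L →ₗ[ℤ] UnitAddCircle // q • φ = 0} :=
    Finite.of_equiv _ (homZModEquiv L q)
  exact h

lemma natCard_hom_zmod (L : Type*) [AddCommGroup L] [Module.Finite ℤ L] [Module.Free ℤ L]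
    (q : ℕ) : Nat.card (L →ₗ[ℤ] ZMod q) = q ^ finrank ℤ L := by
  rw [← Nat.card_congr ((Module.finBasis ℤ L).constr ℤ (M' := ZMod q)).toEquiv]
  simp [Nat.card_fun]

/-- The rational row space of an integer matrix. -/
def rowSpaceQ {ι κ : Type*} (M : Matrix ι κ ℤ) : Submodule ℚ (κ → ℚ) :=
  Submodule.span ℚ (Set.range (M.map (Int.cast : ℤ → ℚ)).row)

lemma rkQ_eq_finrank {ι κ : Type*} [Fintype ι] [Fintype κ] (M : Matrix ι κ ℤ) :
    rkQ M = finrank ℚ (rowSpaceQ M) :=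
  Matrix.rank_eq_finrank_span_row _

lemma row_mem_integralPoints {ι κ : Type*} (M : Matrix ι κ ℤ) (i : ι) :
    M i ∈ integralPoints (rowSpaceQ M) :=
  Submodule.subset_span ⟨i, rfl⟩

/-- The homomorphism `φ` vanishes on every row of `M` that lies in its domain. -/
def KillsRows {ι κ : Type*} {V : Submodule ℚ (κ → ℚ)} (M : Matrix ι κ ℤ)
    (φ : integralPoints V →ₗ[ℤ] UnitAddCircle) : Prop :=
  ∀ i, ∀ h : M i ∈ integralPoints V, φ ⟨M i, h⟩ = 0

lemma natCard_mulVec_eq_zero {ι : Type*} {n : ℕ} (M : Matrix ι (Fin n) ℤ)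
    {V : Submodule ℚ (Fin n → ℚ)} (hV : rowSpaceQ M = V) (q : ℕ) [NeZero q] :
    Nat.card {x : Fin n → ZMod q // ∀ i, (M.map (Int.cast : ℤ → ZMod q)).mulVec x i = 0} =
      q ^ (n - finrank ℚ V) *
        Nat.card {φ : integralPoints V →ₗ[ℤ] UnitAddCircle // q • φ = 0 ∧ KillsRows M φ} := by
  subst hV
  set Λ := integralPoints (rowSpaceQ M) with hΛ
  obtain ⟨N, hN⟩ := exists_isCompl_integralPoints (rowSpaceQ M)
  have hrank : finrank ℤ N = n - finrank ℚ (rowSpaceQ M) := by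
    have h1 : finrank ℤ Λ = finrank ℚ (rowSpaceQ M) := finrank_integralPoints (by
      refine Submodule.span_le.mpr ?_
      rintro _ ⟨i, rfl⟩
      exact Submodule.subset_span ⟨M i, row_mem_integralPoints M i, rfl⟩)
    have h2 := (Submodule.prodEquivOfIsCompl Λ N hN).finrank_eq
    rw [Module.finrank_prod, Module.finrank_fin_fun] at h2
    omega
  rw [← hrank, ← natCard_hom_zmod, mul_comm, ← Nat.card_prod]
  let e : (Fin n → ZMod q) ≃ (Λ →ₗ[ℤ] ZMod q) × (N →ₗ[ℤ] ZMod q) :=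
    (((Pi.basisFun ℤ (Fin n)).constr ℤ (M' := ZMod q)).trans
      ((LinearEquiv.congrLeft (ZMod q) ℤ (Submodule.prodEquivOfIsCompl Λ N hN).symm).trans
        (LinearMap.coprodEquiv ℤ).symm)).toEquiv
  have he : ∀ x (y : Λ), (e x).1 y = ∑ k, (y.1 k : ZMod q) * x k := by
    intro x y
    have : (e x).1 y = (Pi.basisFun ℤ (Fin n)).constr ℤ x y.1 := by
      simp [e]
    rw [this, Basis.constr_apply_fintype]
    simp
  refine Nat.card_congr ((Equiv.subtypeEquiv e (q := fun p => ∀ i,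
    p.1 ⟨M i, row_mem_integralPoints M i⟩ = 0) fun x => ?_).trans (?_ : _ ≃ {f : Λ →ₗ[ℤ] ZMod q //
      ∀ i, f ⟨M i, row_mem_integralPoints M i⟩ = 0} × (N →ₗ[ℤ] ZMod q)) |>.trans
        (Equiv.prodCongr ?_ (Equiv.refl _)))
  · simp only [he]
    rfl
  · exact
      { toFun := fun p => (⟨p.1.1, p.2⟩, p.1.2)
        invFun := fun p => ⟨(p.1.1, p.2), p.1.2⟩
        left_inv := fun _ => rfl
        right_inv := fun _ => rfl }
  · refine (Equiv.subtypeEquiv (homZModEquiv Λ q) (q := fun φ => KillsRows M φ.1)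
      fun f => ?_).trans (Equiv.subtypeSubtypeEquivSubtypeInter _ _)
    exact forall_congr' fun i =>
      ⟨fun h _ => (homZModEquiv_apply_eq_zero f _).mpr h,
        fun h => (homZModEquiv_apply_eq_zero f _).mp (h (row_mem_integralPoints M i))⟩

lemma smul_eq_zero_of_killsRows {ι κ : Type*} [Fintype ι] [Fintype κ] [DecidableEq ι]
    [DecidableEq κ] (M : Matrix ι κ ℤ) {V : Submodule ℚ (κ → ℚ)} (hV : rowSpaceQ M = V)
    {φ : integralPoints V →ₗ[ℤ] UnitAddCircle} (hφ : KillsRows M φ) :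
    invFactor M (rkQ M) • φ = 0 := by
  subst hV
  ext ⟨y, hy⟩
  have hle : Submodule.span ℤ (Set.range M.row) ≤
      (LinearMap.ker φ).map (integralPoints (rowSpaceQ M)).subtype := by
    refine Submodule.span_le.mpr ?_
    rintro _ ⟨i, rfl⟩
    exact ⟨⟨M i, row_mem_integralPoints M i⟩, hφ i _, rfl⟩
  obtain ⟨z, hz, hzy⟩ := hle (invFactor_smul_mem_span_row M hy)
  have hzy' : z = invFactor M (rkQ M) • (⟨y, hy⟩ : integralPoints (rowSpaceQ M)) := by
    ext1
    rw [← natCast_zsmul]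
    exact hzy
  change invFactor M (rkQ M) • φ ⟨y, hy⟩ = 0
  rw [← map_nsmul, ← hzy']
  exact hz

lemma rowSpaceQ_stackJ {m n l : ℕ} (B : Matrix (Fin l) (Fin n) ℤ) (A : Matrix (Fin m) (Fin n) ℤ)
    (J : Finset (Fin m)) : rowSpaceQ (stackJ B A J) =
      rowSpaceQ B ⊔ Submodule.span ℚ ((A.map (Int.cast : ℤ → ℚ)).row '' J) := by
  rw [rowSpaceQ, rowSpaceQ, ← Submodule.span_union]
  congr 1
  ext y
  constructor
  · rintro ⟨i | i, rfl⟩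
    · exact Or.inl ⟨i, rfl⟩
    · exact Or.inr ⟨i.1, i.2, rfl⟩
  · rintro (⟨i, rfl⟩ | ⟨i, hi, rfl⟩)
    · exact ⟨Sum.inl i, rfl⟩
    · exact ⟨Sum.inr ⟨i, hi⟩, rfl⟩

lemma killsRows_stackJ {m n l : ℕ} (B : Matrix (Fin l) (Fin n) ℤ)
    (A : Matrix (Fin m) (Fin n) ℤ) {J : Finset (Fin m)} {V : Submodule ℚ (Fin n → ℚ)}
    (φ : integralPoints V →ₗ[ℤ] UnitAddCircle) : KillsRows (stackJ B A J) φ ↔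
      KillsRows B φ ∧ ∀ i ∈ J, ∀ h : A i ∈ integralPoints V, φ ⟨A i, h⟩ = 0 := by
  constructor
  · exact fun h => ⟨fun i => h (Sum.inl i), fun i hi => h (Sum.inr ⟨i, hi⟩)⟩
  · rintro ⟨h₁, h₂⟩ (i | i)
    · exact h₁ i
    · exact h₂ i.1 i.2

open Classical in
/-- The signed number of subfamilies `J` such that the rows of `C_J` span `V` and are all
killed by `φ`. -/
noncomputable def layerWeight {m n l : ℕ} (A : Matrix (Fin m) (Fin n) ℤ)
    (B : Matrix (Fin l) (Fin n) ℤ) {V : Submodule ℚ (Fin n → ℚ)}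
    (φ : integralPoints V →ₗ[ℤ] UnitAddCircle) : ℤ :=
  (-1 : ℤ) ^ (finrank ℚ V + rkQ B) *
    ∑ J : Finset (Fin m),
      if rowSpaceQ (stackJ B A J) = V ∧ KillsRows (stackJ B A J) φ then (-1 : ℤ) ^ J.card else 0

lemma layerWeight_nonneg {m n l : ℕ} (A : Matrix (Fin m) (Fin n) ℤ)
    (B : Matrix (Fin l) (Fin n) ℤ) {V : Submodule ℚ (Fin n → ℚ)}
    (φ : integralPoints V →ₗ[ℤ] UnitAddCircle) : 0 ≤ layerWeight A B φ := by
  classical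
  by_cases hB : KillsRows B φ
  · let E : Finset (Fin m) :=
      Finset.univ.filter fun i => ∀ h : A i ∈ integralPoints V, φ ⟨A i, h⟩ = 0
    have h := alternating_spanning_sum_nonneg (A.map (Int.cast : ℤ → ℚ)).row V E (rowSpaceQ B)
    rw [← rkQ_eq_finrank] at h
    convert h using 1
    rw [layerWeight]
    congr 1
    rw [← Finset.sum_subset (Finset.subset_univ E.powerset)]
    · refine Finset.sum_congr rfl fun J hJ => ?_
      rw [rowSpaceQ_stackJ, killsRows_stackJ]
      have : ∀ i ∈ J, ∀ h : A i ∈ integralPoints V, φ ⟨A i, h⟩ = 0 := fun i hi =>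
        (Finset.mem_filter.mp (Finset.mem_powerset.mp hJ hi)).2
      simp only [hB, true_and]
      congr 1
      simp only [eq_iff_iff, and_iff_left_iff_imp]
      exact fun _ => this
    · intro J _ hJ
      refine if_neg fun h => hJ (Finset.mem_powerset.mpr fun i hi => ?_)
      exact Finset.mem_filter.mpr ⟨Finset.mem_univ i, ((killsRows_stackJ B A φ).mp h.2).2 i hi⟩
  · refine le_of_eq (Eq.symm (mul_eq_zero_of_right _ (Finset.sum_eq_zero fun J _ => if_neg ?_)))
    exact fun h => hB ((killsRows_stackJ B A φ).mp h.2).1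

lemma rhoC0_smul_eq_zero {m n l : ℕ} {A : Matrix (Fin m) (Fin n) ℤ}
    {B : Matrix (Fin l) (Fin n) ℤ} {V : Submodule ℚ (Fin n → ℚ)}
    {φ : integralPoints V →ₗ[ℤ] UnitAddCircle} (hφ : layerWeight A B φ ≠ 0) :
    rhoC0 A B • φ = 0 := by
  obtain ⟨J, -, hJ⟩ := Finset.exists_ne_zero_of_sum_ne_zero (right_ne_zero_of_mul hφ)
  have hJ' : rowSpaceQ (stackJ B A J) = V ∧ KillsRows (stackJ B A J) φ := by
    by_contra h
    exact hJ (if_neg h)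
  obtain ⟨c, hc⟩ : invFactor (stackJ B A J) (rkQ (stackJ B A J)) ∣ rhoC0 A B :=
    Finset.dvd_lcm (f := fun J : Finset (Fin m) =>
      invFactor (stackJ B A J) (rkQ (stackJ B A J))) (Finset.mem_univ J)
  rw [hc, mul_comm, mul_smul, smul_eq_zero_of_killsRows _ hJ'.1 hJ'.2, smul_zero]

open Classical in
/-- The rational subspaces of dimension `j` spanned by the rows of some `C_J`. -/
noncomputable def spannedSubspaces {m n l : ℕ} (A : Matrix (Fin m) (Fin n) ℤ)
    (B : Matrix (Fin l) (Fin n) ℤ) (j : ℕ) : Finset (Submodule ℚ (Fin n → ℚ)) :=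
  (Finset.univ.filter fun J => rkQ (stackJ B A J) = j).image fun J => rowSpaceQ (stackJ B A J)

/-- The `q`-torsion homomorphisms from the integral points of `V` to the circle. -/
noncomputable def torsionHoms {n : ℕ} (V : Submodule ℚ (Fin n → ℚ)) (q : ℕ) [NeZero q] :
    Finset (integralPoints V →ₗ[ℤ] UnitAddCircle) :=
  (finite_torsion_hom (integralPoints V) q).toFinset

lemma mem_torsionHoms {n : ℕ} {V : Submodule ℚ (Fin n → ℚ)} {q : ℕ} [NeZero q]
    {φ : integralPoints V →ₗ[ℤ] UnitAddCircle} : φ ∈ torsionHoms V q ↔ q • φ = 0 :=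
  Set.Finite.mem_toFinset _

lemma Sj0_eq_sum_layerWeight {m n l : ℕ} (A : Matrix (Fin m) (Fin n) ℤ)
    (B : Matrix (Fin l) (Fin n) ℤ) {j : ℕ} (hj : rkQ B ≤ j) (q : ℕ) [NeZero q] :
    Sj0 A B j q = (q : ℤ) ^ (n - j) *
      ∑ V ∈ spannedSubspaces A B j, ∑ φ ∈ torsionHoms V q, layerWeight A B φ := by
  classical
  have hsign : (-1 : ℤ) ^ (j - rkQ B) = (-1) ^ (j + rkQ B) := by
    obtain ⟨k, rfl⟩ := Nat.exists_eq_add_of_le hj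
    rw [Nat.add_sub_cancel_left, show rkQ B + k + rkQ B = k + 2 * rkQ B by ring, pow_add]
    simp
  rw [Sj0, hsign, ← Finset.sum_fiberwise_of_maps_to (t := spannedSubspaces A B j)
    (g := fun J => rowSpaceQ (stackJ B A J)) fun J hJ => Finset.mem_image_of_mem _ hJ,
    Finset.mul_sum, Finset.mul_sum]
  refine Finset.sum_congr rfl fun V hV => ?_
  have hVj : finrank ℚ V = j := by
    obtain ⟨J, hJ, rfl⟩ := Finset.mem_image.mp hV
    rw [← rkQ_eq_finrank]
    exact (Finset.mem_filter.mp hJ).2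
  have hfil : (Finset.univ.filter fun J => rkQ (stackJ B A J) = j).filter
      (fun J => rowSpaceQ (stackJ B A J) = V) =
      Finset.univ.filter fun J => rowSpaceQ (stackJ B A J) = V := by
    ext J
    simp only [Finset.mem_filter, Finset.mem_univ, true_and, and_iff_right_iff_imp]
    rintro rfl
    rw [rkQ_eq_finrank, hVj]
  have hcount : ∀ J ∈ Finset.univ.filter fun J => rowSpaceQ (stackJ B A J) = V,
      (-1 : ℤ) ^ J.card * (Nat.card {x : Fin n → ZMod q //
          ∀ i, ((stackJ B A J).map (Int.cast : ℤ → ZMod q)).mulVec x i = 0} : ℤ) =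
        (q : ℤ) ^ (n - j) * ∑ φ ∈ torsionHoms V q,
          if KillsRows (stackJ B A J) φ then (-1 : ℤ) ^ J.card else 0 := by
    intro J hJ
    rw [natCard_mulVec_eq_zero _ (Finset.mem_filter.mp hJ).2, hVj, ← Finset.sum_filter,
      Finset.sum_const, Nat.subtype_card ((torsionHoms V q).filter
        fun φ => KillsRows (stackJ B A J) φ) (fun φ => by
          rw [Finset.mem_filter, mem_torsionHoms])]
    push_cast
    rw [nsmul_eq_mul]
    ring
  rw [hfil, Finset.sum_congr rfl hcount, ← Finset.mul_sum, Finset.sum_comm, mul_left_comm]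
  simp only [layerWeight, hVj, ite_and, ← Finset.sum_filter, ← Finset.mul_sum]

end

/-- Central case (`𝒂 = 0`, `𝒃 = 0`). Let `r = rank B` and
`s = rank [B; A]`. For all positive integers `a`, `b` with `gcd(a, ρ_C) ∣ gcd(b, ρ_C)`
and every `r ≤ j ≤ s`, one has `0 ≤ S_j(a)` and `b^{n−j} S_j(a) ≤ a^{n−j} S_j(b)`. -/
theorem statement11 {m n l : ℕ} (A : Matrix (Fin m) (Fin n) ℤ)
    (B : Matrix (Fin l) (Fin n) ℤ)
    (u v : ℕ) (hu : 0 < u) (hv : 0 < v)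
    (hgcd : Nat.gcd u (rhoC0 A B) ∣ Nat.gcd v (rhoC0 A B)) :
    ∀ j : ℕ, rkQ B ≤ j → j ≤ rkQ (Matrix.fromRows B A) →
      0 ≤ Sj0 A B j u ∧
      (v : ℤ) ^ (n - j) * Sj0 A B j u ≤ (u : ℤ) ^ (n - j) * Sj0 A B j v := by
  intro j hj _
  have : NeZero u := ⟨hu.ne'⟩
  have : NeZero v := ⟨hv.ne'⟩
  rw [Sj0_eq_sum_layerWeight A B hj u, Sj0_eq_sum_layerWeight A B hj v]
  refine ⟨mul_nonneg (by positivity) (Finset.sum_nonneg fun V _ => Finset.sum_nonneg fun φ _ =>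
    layerWeight_nonneg A B φ), ?_⟩
  rw [mul_left_comm]
  refine mul_le_mul_of_nonneg_left (mul_le_mul_of_nonneg_left ?_ (by positivity)) (by positivity)
  refine Finset.sum_le_sum fun V _ => ?_
  classical
  rw [← Finset.sum_filter_ne_zero]
  refine Finset.sum_le_sum_of_subset_of_nonneg (fun φ hφ => ?_)
    fun φ _ _ => layerWeight_nonneg A B φ
  obtain ⟨hφu, hφ0⟩ := Finset.mem_filter.mp hφ
  have hdvd : addOrderOf φ ∣ Nat.gcd u (rhoC0 A B) :=
    Nat.dvd_gcd (addOrderOf_dvd_of_nsmul_eq_zero (mem_torsionHoms.mp hφu))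
      (addOrderOf_dvd_of_nsmul_eq_zero (rhoC0_smul_eq_zero hφ0))
  exact mem_torsionHoms.mpr
    (addOrderOf_dvd_iff_nsmul_eq_zero.mp ((hdvd.trans hgcd).trans (Nat.gcd_dvd_left _ _)))
end

section
/- Let p and q be positive integers. If G admits a (ℤ/pqℤ, b)-flow (not necessarily nowhere-zero), then the number of nowhere-zero (ℤ/qℤ, b)-flows of G is at most the number of nowhere-zero (ℤ/pqℤ, b)-flows of G. -/
/-- The net inflow at `v` of an edge function `f` on an oriented graph with head map `h` and tail
map `t`. -/
def netInflow {V E A : Type*} [Fintype E] [DecidableEq V] [AddCommGroup A]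
    (h t : E → V) (f : E → A) (v : V) : A :=
  (∑ e ∈ Finset.univ.filter (fun e : E => h e = v), f e) -
    (∑ e ∈ Finset.univ.filter (fun e : E => t e = v), f e)

section NetInflow

variable {V E A B : Type*} [Fintype E] [DecidableEq V] [AddCommGroup A] [AddCommGroup B]

theorem map_netInflow (φ : A →+ B) (h t : E → V) (f : E → A) (v : V) :
    netInflow h t (fun e => φ (f e)) v = φ (netInflow h t f v) := by
  simp [netInflow]

/-- The net inflow as an additive homomorphism from edge functions to vertex functions. -/
def netInflowHom (h t : E → V) : (E → A) →+ (V → A) :=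
  AddMonoidHom.mk' (netInflow h t) fun f g => by
    ext v
    simp only [netInflow, Pi.add_apply, Finset.sum_add_distrib]
    abel

theorem netInflowHom_apply (h t : E → V) (f : E → A) (v : V) :
    netInflowHom h t f v = netInflow h t f v := rfl

theorem netInflowHom_single [DecidableEq E] (h t : E → V) (e : E) (a : A) :
    netInflowHom h t (Pi.single e a) = Pi.single (h e) a - Pi.single (t e) a := by
  ext v
  simp [netInflowHom_apply, netInflow, Pi.single_apply, eq_comm]

/-- The net inflow sums to zero over any fibre of a map that identifies the ends of each edge. -/
theorem sum_netInflow_fiber [Fintype V] {Q : Type*} [DecidableEq Q] (h t : E → V) (π : V → Q)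
    (hπ : ∀ e, π (h e) = π (t e)) (f : E → A) (x : Q) :
    ∑ v ∈ Finset.univ.filter (fun v => π v = x), netInflow h t f v = 0 := by
  have key (s : E → V) : ∑ v ∈ Finset.univ.filter (fun v => π v = x),
      ∑ e ∈ Finset.univ.filter (fun e : E => s e = v), f e =
      ∑ e ∈ Finset.univ.filter (fun e : E => π (s e) = x), f e := by
    simp only [Finset.sum_filter]
    simp_rw [← Finset.sum_filter (fun v => π v = x)]
    rw [Finset.sum_comm]
    simp [Finset.sum_ite_eq]
  simp only [netInflow, Finset.sum_sub_distrib, key, hπ, sub_self]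

/-- The cokernel of the integral net inflow map is torsion-free. -/
theorem exists_netInflow_eq_of_mul [Fintype V] (h t : E → V) {n : ℤ} (hn : n ≠ 0)
    (c : V → ℤ) (g : E → ℤ) (hg : ∀ v, netInflow h t g v = n * c v) :
    ∃ k : E → ℤ, ∀ v, netInflow h t k v = c v := by
  classical
  let r : V → V → Prop := fun u v => ∃ e, h e = u ∧ t e = v
  let S : AddSubgroup (V → ℤ) := (netInflowHom h t).range
  let φ : Quot r → (V → ℤ) ⧸ S :=
    Quot.lift (fun v => QuotientAddGroup.mk' S (Pi.single v 1)) <| by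
      rintro _ _ ⟨e, rfl, rfl⟩
      rw [← sub_eq_zero, ← map_sub, ← netInflowHom_single]
      exact (QuotientAddGroup.eq_zero_iff _).2 ⟨_, rfl⟩
  have hzero (x : Quot r) : ∑ v ∈ Finset.univ.filter (fun v => Quot.mk r v = x), c v = 0 := by
    have := sum_netInflow_fiber h t (Quot.mk r) (fun e => Quot.sound ⟨e, rfl, rfl⟩) g x
    simp only [hg, ← Finset.mul_sum] at this
    exact (mul_eq_zero.1 this).resolve_left hn
  have hc : QuotientAddGroup.mk' S c = 0 := by
    have hsum : c = ∑ v, c v • (Pi.single v 1 : V → ℤ) := by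
      ext w
      simp [Finset.sum_apply, Pi.single_apply]
    have : Fintype (Quot r) := Fintype.ofFinite _
    calc QuotientAddGroup.mk' S c
        = ∑ v, c v • φ (Quot.mk r v) := by
          conv_lhs => rw [hsum]
          simp only [map_sum, map_zsmul]
          rfl
      _ = ∑ x, ∑ v ∈ Finset.univ.filter (fun v => Quot.mk r v = x),
            c v • φ (Quot.mk r v) := (Finset.sum_fiberwise _ _ _).symm
      _ = ∑ x, (∑ v ∈ Finset.univ.filter (fun v => Quot.mk r v = x), c v) • φ x := by
          refine Finset.sum_congr rfl fun x _ => ?_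
          refine Eq.trans (Finset.sum_congr rfl fun v hv => ?_)
            (map_sum (zmultiplesHom _ (φ x)) c _).symm
          rw [(Finset.mem_filter.1 hv).2, zmultiplesHom_apply]
      _ = 0 := by simp [hzero]
  obtain ⟨k, hk⟩ := (QuotientAddGroup.eq_zero_iff c).1 hc
  exact ⟨k, congrFun hk⟩

theorem netInflow_intCast (R : Type*) [Ring R] (h t : E → V) (f : E → ℤ) (v : V) :
    netInflow h t (fun e => (f e : R)) v = ((netInflow h t f v : ℤ) : R) :=
  map_netInflow (Int.castAddHom R) h t f v

/-- If a graph admits a `(ℤ/mℤ, b)`-flow and `q ∣ m`, every `(ℤ/qℤ, b)`-flow lifts to a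
`(ℤ/mℤ, b)`-flow. -/
theorem exists_lift_flow [Fintype V] (h t : E → V) (b : V → ℤ) {m q : ℕ} (hq : 0 < q)
    (hqm : q ∣ m) (f₀ : E → ZMod m) (hf₀ : ∀ v, netInflow h t f₀ v = (b v : ZMod m))
    (f : E → ZMod q) (hf : ∀ v, netInflow h t f v = (b v : ZMod q)) :
    ∃ f' : E → ZMod m, (∀ e, ZMod.castHom hqm (ZMod q) (f' e) = f e) ∧
      ∀ v, netInflow h t f' v = (b v : ZMod m) := by
  choose F hF using fun e => ZMod.intCast_surjective (f e)
  choose F₀ hF₀ using fun e => ZMod.intCast_surjective (f₀ e)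
  obtain rfl : (fun e => (F e : ZMod q)) = f := funext hF
  obtain rfl : (fun e => (F₀ e : ZMod m)) = f₀ := funext hF₀
  simp only [netInflow_intCast] at hf hf₀
  have hdvd (v : V) : (q : ℤ) ∣ netInflow h t (F - F₀) v := by
    have h₀ := congrArg (ZMod.castHom hqm (ZMod q)) (hf₀ v)
    simp only [map_intCast] at h₀
    rw [← ZMod.intCast_zmod_eq_zero_iff_dvd, ← netInflowHom_apply, map_sub, Pi.sub_apply,
      Int.cast_sub, netInflowHom_apply, netInflowHom_apply, hf, h₀, sub_self]
  choose c hc using hdvd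
  obtain ⟨k, hk⟩ := exists_netInflow_eq_of_mul h t (by exact_mod_cast hq.ne') c _ hc
  refine ⟨fun e => ((F - (q : ℤ) • k) e : ℤ), fun e => by rw [map_intCast]; simp, fun v => ?_⟩
  rw [netInflow_intCast, ← hf₀]
  congr 1
  have hc := hc v
  rw [← netInflowHom_apply, map_sub, Pi.sub_apply, netInflowHom_apply, netInflowHom_apply] at hc
  rw [← netInflowHom_apply, map_sub, map_zsmul, Pi.sub_apply, Pi.smul_apply, netInflowHom_apply,
    netInflowHom_apply, hk, smul_eq_mul]
  linarith

end NetInflow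


/-- Let `p`, `q` be positive integers. If the graph admits a
`(ℤ/pqℤ, b)`-flow (not necessarily nowhere-zero), then the number of nowhere-zero
`(ℤ/qℤ, b)`-flows is at most the number of nowhere-zero `(ℤ/pqℤ, b)`-flows. -/
theorem statement18 {V E : Type*} [Fintype V] [Fintype E] [DecidableEq V]
    (h t : E → V) (b : V → ℤ) (p q : ℕ) (hp : 0 < p) (hq : 0 < q)
    (hflow : ∃ f : E → ZMod (p * q),
      ∀ v : V,
        (∑ e ∈ Finset.univ.filter (fun e : E => h e = v), f e) -
          (∑ e ∈ Finset.univ.filter (fun e : E => t e = v), f e) =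
        (b v : ZMod (p * q))) :
    Nat.card {f : E → ZMod q //
        (∀ e : E, f e ≠ 0) ∧
        ∀ v : V,
          (∑ e ∈ Finset.univ.filter (fun e : E => h e = v), f e) -
            (∑ e ∈ Finset.univ.filter (fun e : E => t e = v), f e) =
          (b v : ZMod q)} ≤
      Nat.card {f : E → ZMod (p * q) //
        (∀ e : E, f e ≠ 0) ∧
        ∀ v : V,
          (∑ e ∈ Finset.univ.filter (fun e : E => h e = v), f e) -
            (∑ e ∈ Finset.univ.filter (fun e : E => t e = v), f e) =
          (b v : ZMod (p * q))} := by
  obtain ⟨f₀, hf₀⟩ := hflow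
  have : NeZero (p * q) := ⟨(Nat.mul_pos hp hq).ne'⟩
  choose F hred hF using
    exists_lift_flow h t b hq (Nat.dvd_mul_left q p) f₀ hf₀
  refine Nat.card_le_card_of_injective
    (fun f => ⟨F f.1 f.2.2, fun e he => f.2.1 e ?_, hF f.1 f.2.2⟩) fun f g hfg => ?_
  · rw [← hred f.1 f.2.2 e, he, map_zero]
  · ext1
    funext e
    rw [← hred f.1 f.2.2 e, ← hred g.1 g.2.2 e]
    exact congrArg _ (congrFun (congrArg Subtype.val hfg) e)
end
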